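/- (Axiomatization of repetition-proof valuation congruence) For all propositional statements P and Q: CP_rp ⊢ P = Q if and only if P =_rp Q, where CP_rp is CP extended with the axiom schemes (CPrp1) (x◁a▷y)◁a▷z = (x◁a▷x)◁a▷z and (CPrp2) x◁a▷(y◁a▷z) = x◁a▷(z◁a▷z) for all a ∈ A. -/

import Mathlib

/-- Propositional statements over atoms `A`: constants `T`, `F`, an atom `a`
for each `a ∈ A`, and the ternary conditional composition
`cond x y z = x ◁ y ▷ z` (with `y` the central condition). -/
inductive PS (A : Type) : Type where
  | tt : PS A
  | ff : PS A
  | atom : A → PS A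
  | cond : PS A → PS A → PS A → PS A

/-- A valuation algebra (VA) over `A`. -/
structure VA (A : Type) where
  Val : Type
  Tv : Val
  Fv : Val
  yd : A → Val → Bool
  dv : A → Val → Val
  yd_T : ∀ a, yd a Tv = true
  yd_F : ∀ a, yd a Fv = false
  dv_T : ∀ a, dv a Tv = Tv
  dv_F : ∀ a, dv a Fv = Fv

variable {A : Type}

mutual
  /-- Evaluation `P/H` of a propositional statement over a valuation `H`. -/
  def PS.eval (V : VA A) : PS A → V.Val → Bool
    | .tt, _ => true
    | .ff, _ => false
    | .atom a, H => V.yd a H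
    | .cond p q r, H =>
        if PS.eval V q H then PS.eval V p (PS.deriv V q H)
        else PS.eval V r (PS.deriv V q H)
  /-- The generalized derivative `∂_P(H)`. -/
  def PS.deriv (V : VA A) : PS A → V.Val → V.Val
    | .tt, H => H
    | .ff, H => H
    | .atom a, H => V.dv a H
    | .cond p q r, H =>
        if PS.eval V q H then PS.deriv V p (PS.deriv V q H)
        else PS.deriv V r (PS.deriv V q H)
end

/-- `K`-equivalence: equal evaluation results in all members of the class `K`. -/
def KEquiv (K : VA A → Prop) (P Q : PS A) : Prop :=
  ∀ V : VA A, K V → ∀ H : V.Val, PS.eval V P H = PS.eval V Q H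

/-- A congruence with respect to conditional composition. -/
def IsCondCongruence (R : PS A → PS A → Prop) : Prop :=
  Equivalence R ∧
    ∀ ⦃x x' y y' z z' : PS A⦄, R x x' → R y y' → R z z' →
      R (PS.cond x y z) (PS.cond x' y' z')

/-- `K`-congruence: the largest congruence contained in `K`-equivalence. -/
def KCong (K : VA A → Prop) (P Q : PS A) : Prop :=
  ∃ R : PS A → PS A → Prop,
    IsCondCongruence R ∧ (∀ x y, R x y → KEquiv K x y) ∧ R P Q

/-- Derivability (of closed equations) in equational logic from the axioms `CP`
together with an additional set `Ax` of equational axioms. -/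
inductive Deriv (Ax : PS A → PS A → Prop) : PS A → PS A → Prop where
  | ax {p q} : Ax p q → Deriv Ax p q
  | cp1 (x y) : Deriv Ax (.cond x .tt y) x
  | cp2 (x y) : Deriv Ax (.cond x .ff y) y
  | cp3 (x) : Deriv Ax (.cond .tt x .ff) x
  | cp4 (x y z u v) :
      Deriv Ax (.cond x (.cond y z u) v)
               (.cond (.cond x y v) z (.cond x u v))
  | refl (x) : Deriv Ax x x
  | symm {p q} : Deriv Ax p q → Deriv Ax q p
  | trans {p q r} : Deriv Ax p q → Deriv Ax q r → Deriv Ax p r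
  | congr {x x' y y' z z'} : Deriv Ax x x' → Deriv Ax y y' → Deriv Ax z z' →
      Deriv Ax (.cond x y z) (.cond x' y' z')

/-- No additional axioms: plain `CP`. -/
def NoAx : PS A → PS A → Prop := fun _ _ => False

/-- The class `fr` of free valuation algebras: all VAs. -/
def frK : VA A → Prop := fun _ => True

/-- The class `rp` of repetition-proof VAs. -/
def rpK (V : VA A) : Prop :=
  ∀ (a : A) (x : V.Val), V.yd a x = V.yd a (V.dv a x)

/-- The class `cr` of contractive VAs. -/
def crK (V : VA A) : Prop :=
  rpK V ∧ ∀ (a : A) (x : V.Val), V.dv a (V.dv a x) = V.dv a x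

/-- The class `wm` of weakly memorizing VAs. -/
def wmK (V : VA A) : Prop :=
  crK V ∧ ∀ (a b : A) (x : V.Val),
    V.yd b (V.dv a x) = V.yd a x →
      V.dv a (V.dv b (V.dv a x)) = V.dv b (V.dv a x) ∧
      V.yd a (V.dv b (V.dv a x)) = V.yd a x

/-- The class `mem` of memorizing VAs. -/
def memK (V : VA A) : Prop :=
  crK V ∧ ∀ (a b : A) (x : V.Val),
    V.dv a (V.dv b (V.dv a x)) = V.dv b (V.dv a x) ∧
    V.yd a (V.dv b (V.dv a x)) = V.yd a x

/-- The class `st` of static VAs. -/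
def stK (V : VA A) : Prop :=
  ∀ (a b : A) (x : V.Val), V.yd a (V.dv b x) = V.yd a x

/-- The axiom schemes `(CPrp1)` and `(CPrp2)` (for `a ∈ A`). -/
inductive RpAx {A : Type} : PS A → PS A → Prop where
  | rp1 (a : A) (x y z : PS A) :
      RpAx (.cond (.cond x (.atom a) y) (.atom a) z)
           (.cond (.cond x (.atom a) x) (.atom a) z)
  | rp2 (a : A) (x y z : PS A) :
      RpAx (.cond x (.atom a) (.cond y (.atom a) z))
           (.cond x (.atom a) (.cond z (.atom a) z))

/-- Basic forms: binary decision trees over `A` with Boolean leaves. -/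
inductive BasicForm (A : Type) : Type where
  | leaf : Bool → BasicForm A
  | node : A → BasicForm A → BasicForm A → BasicForm A

namespace BasicForm

/-- The propositional statement denoted by a basic form. -/
def toPS : BasicForm A → PS A
  | leaf true => .tt
  | leaf false => .ff
  | node a l r => .cond l.toPS (.atom a) r.toPS

/-- Replace the leaves `true` by `p` and the leaves `false` by `r`. -/
def subst (p r : BasicForm A) : BasicForm A → BasicForm A
  | leaf true => p
  | leaf false => r
  | node a s t => node a (subst p r s) (subst p r t)

/-- The value and the final history reached when a basic form is evaluated with the oracle `f`,
which answers an atom depending on the (reversed) history of atoms evaluated so far. -/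
def run (f : A → List A → Bool) : BasicForm A → List A → Bool × List A
  | leaf b, h => (b, h)
  | node a l r, h => if f a h then run f l (a :: h) else run f r (a :: h)

theorem deriv_toPS_subst (Ax : PS A → PS A → Prop) (p q r : BasicForm A) :
    Deriv Ax (.cond p.toPS q.toPS r.toPS) (subst p r q).toPS := by
  induction q with
  | leaf b =>
    cases b
    · exact .cp2 ..
    · exact .cp1 ..
  | node a s t ihs iht =>
    exact .trans (.cp4 ..) (.congr ihs (.refl _) iht)

theorem exists_deriv_toPS (Ax : PS A → PS A → Prop) (P : PS A) :
    ∃ t : BasicForm A, Deriv Ax P t.toPS := by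
  induction P with
  | tt => exact ⟨leaf true, .refl _⟩
  | ff => exact ⟨leaf false, .refl _⟩
  | atom a => exact ⟨node a (leaf true) (leaf false), .symm (.cp3 _)⟩
  | cond p q r ihp ihq ihr =>
    obtain ⟨p', hp⟩ := ihp
    obtain ⟨q', hq⟩ := ihq
    obtain ⟨r', hr⟩ := ihr
    exact ⟨subst p' r' q', .trans (.congr hp hq hr) (deriv_toPS_subst Ax p' q' r')⟩

theorem suffix_run (f : A → List A → Bool) (t : BasicForm A) (h : List A) :
    h <:+ (run f t h).2 := by
  induction t generalizing h with
  | leaf b => exact List.suffix_rfl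
  | node a l r ihl ihr =>
    rw [run]
    split
    · exact (List.suffix_cons a h).trans (ihl _)
    · exact (List.suffix_cons a h).trans (ihr _)

theorem cons_suffix_run_node (f : A → List A → Bool) (a : A) (l r : BasicForm A) (h : List A) :
    a :: h <:+ (run f (node a l r) h).2 := by
  rw [run]
  split <;> exact suffix_run ..

theorem run_congr {f g : A → List A → Bool} {N : ℕ}
    (hfg : ∀ a h, h.length ≤ N → g a h = f a h) (t : BasicForm A) (h : List A)
    (ht : (run f t h).2.length ≤ N) : run g t h = run f t h := by
  induction t generalizing h with
  | leaf b => rfl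
  | node a l r ihl ihr =>
    rw [run] at ht ⊢
    have hh : h.length ≤ N := by
      refine le_trans ?_ ht
      split
      · exact ((List.suffix_cons a h).trans (suffix_run f l _)).length_le
      · exact ((List.suffix_cons a h).trans (suffix_run f r _)).length_le
    rw [hfg a h hh, run]
    split at ht
    next hv => simp only [hv, if_true]; exact ihl _ ht
    next hv => simp only [hv]; exact ihr _ ht

end BasicForm

/-- An oracle is repetition-proof if asking an atom twice in a row yields the same answer. -/
def RepetitionProof (f : A → List A → Bool) : Prop :=
  ∀ a h, f a (a :: h) = f a h

/-- The valuation algebra of histories answered by an oracle, with `T` and `F` adjoined. -/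
def historyVA (f : A → List A → Bool) : VA A where
  Val := Bool ⊕ List A
  Tv := .inl true
  Fv := .inl false
  yd a := Sum.elim id (f a)
  dv a := Sum.map id (List.cons a)
  yd_T _ := rfl
  yd_F _ := rfl
  dv_T _ := rfl
  dv_F _ := rfl

theorem rpK_historyVA {f : A → List A → Bool} (hf : RepetitionProof f) : rpK (historyVA f) := by
  rintro a (b | h)
  · rfl
  · exact (hf a h).symm

theorem eval_deriv_toPS (f : A → List A → Bool) (t : BasicForm A) (h : List A) :
    t.toPS.eval (historyVA f) (.inr h) = (t.run f h).1 ∧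
      t.toPS.deriv (historyVA f) (.inr h) = .inr (t.run f h).2 := by
  induction t generalizing h with
  | leaf b =>
    cases b <;> simp only [BasicForm.toPS, BasicForm.run, PS.eval, PS.deriv] <;> exact ⟨trivial, rfl⟩
  | node a l r ihl ihr =>
    have hy : (historyVA f).yd a (.inr h) = f a h := rfl
    have hd : (historyVA f).dv a (.inr h) = .inr (a :: h) := rfl
    simp only [BasicForm.toPS, BasicForm.run, PS.eval, PS.deriv, hy, hd]
    split
    · exact ihl _
    · exact ihr _

/-- The statement that evaluates `a` exactly `n` times and then returns the value of `b`. -/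
def PS.probe (a b : A) : ℕ → PS A
  | 0 => .atom b
  | n + 1 => .cond (probe a b n) (.atom a) (probe a b n)

theorem eval_probe (f : A → List A → Bool) (a b : A) (n : ℕ) (h : List A) :
    (PS.probe a b n).eval (historyVA f) (.inr h) = f b (List.replicate n a ++ h) := by
  induction n generalizing h with
  | zero => simp only [PS.probe, PS.eval]; rfl
  | succ n ih =>
    have hd : (historyVA f).dv a (.inr h) = .inr (a :: h) := rfl
    simp only [PS.probe, PS.eval, PS.deriv, hd, ih, ite_self]
    rw [List.replicate_succ', List.append_assoc]
    rfl

/-- Provable equality is sound for values and derivatives in repetition-proof algebras. -/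
theorem Deriv.sound {P Q : PS A} (h : Deriv RpAx P Q) {V : VA A} (hV : rpK V) (H : V.Val) :
    P.eval V H = Q.eval V H ∧ P.deriv V H = Q.deriv V H := by
  induction h generalizing H with
  | ax h =>
    have hV' := fun a x => (hV a x).symm
    cases h <;> simp only [PS.eval, PS.deriv, hV'] <;> split <;> simp_all
  | cp1 x y => simp [PS.eval, PS.deriv]
  | cp2 x y => simp [PS.eval, PS.deriv]
  | cp3 x => simp [PS.eval, PS.deriv]
  | cp4 x y z u v =>
    simp only [PS.eval, PS.deriv]
    split <;> simp
  | refl x => exact ⟨rfl, rfl⟩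
  | symm _ ih => exact ⟨(ih H).1.symm, (ih H).2.symm⟩
  | trans _ _ ih₁ ih₂ => exact ⟨(ih₁ H).1.trans (ih₂ H).1, (ih₁ H).2.trans (ih₂ H).2⟩
  | congr _ _ _ ihx ihy ihz =>
    simp only [PS.eval, PS.deriv, (ihy H).1, (ihy H).2]
    split
    · exact ihx _
    · exact ihz _

theorem KCong.of_deriv {P Q : PS A} (h : Deriv RpAx P Q) : KCong rpK P Q :=
  ⟨Deriv RpAx, ⟨⟨.refl, .symm, .trans⟩, fun _ _ _ _ _ _ => .congr⟩,
    fun _ _ hxy _ hV H => (hxy.sound hV H).1, h⟩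

theorem KCong.trans_deriv {P P' Q Q' : PS A} (h : KCong rpK P Q) (hP : Deriv RpAx P P')
    (hQ : Deriv RpAx Q Q') (x z : PS A) : KEquiv rpK (.cond x P' z) (.cond x Q' z) := by
  obtain ⟨R, ⟨hR, hc⟩, hK, hPQ⟩ := h
  intro V hV H
  have hx := (Deriv.congr (.refl x) hP (.refl z)).sound hV H
  have hz := (Deriv.congr (.refl x) hQ (.refl z)).sound hV H
  rw [← hx.1, ← hz.1]
  exact hK _ _ (hc (hR.refl x) hPQ (hR.refl z)) V hV H

/-- Basic forms that are indistinguishable in every context reach the same value and the same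
history. -/
theorem run_eq_of_kEquiv [Nontrivial A] {p q : BasicForm A}
    (hpq : ∀ x z, KEquiv rpK (.cond x p.toPS z) (.cond x q.toPS z))
    {f : A → List A → Bool} (hf : RepetitionProof f) (h : List A) :
    p.run f h = q.run f h := by
  classical
  have key (g : A → List A → Bool) (hg : RepetitionProof g) (x z : PS A) :=
    hpq x z (historyVA g) (rpK_historyVA hg) (.inr h)
  simp only [PS.eval, (eval_deriv_toPS _ _ _).1, (eval_deriv_toPS _ _ _).2] at key
  refine Prod.ext ?_ ?_
  · have := key f hf .tt .ff
    simpa [PS.eval] using this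
  by_contra hne
  obtain ⟨a, b, hab⟩ := exists_pair_ne A
  set N := max (p.run f h).2.length (q.run f h).2.length
  let K := List.replicate (N + 1) a ++ (p.run f h).2
  let g : A → List A → Bool := fun x k =>
    if (k.dropWhile (· = x)).length ≤ N then f x k else decide (k.dropWhile (· = x) = K)
  have hg : RepetitionProof g := by
    intro x k
    simp [g, hf x k]
  have hgf : ∀ x k, k.length ≤ N → g x k = f x k := by
    intro x k hk
    exact if_pos ((List.dropWhile_suffix _).length_le.trans hk)
  have hgb (k : List A) : g b (List.replicate (N + 1) a ++ k) =
      decide (List.replicate (N + 1) a ++ k = K) := by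
    have hdrop : (List.replicate (N + 1) a ++ k).dropWhile (· = b) =
        List.replicate (N + 1) a ++ k := by
      simp [List.replicate_succ, hab]
    simp only [g, hdrop]
    exact if_neg (by simp; omega)
  have hkey := key g hg (.probe a b (N + 1)) (.probe a b (N + 1))
  simp only [ite_self, eval_probe] at hkey
  rw [BasicForm.run_congr hgf p h (le_max_left _ _),
    BasicForm.run_congr hgf q h (le_max_right _ _), hgb, hgb] at hkey
  simp [K, Ne.symm hne] at hkey

/-- Provable equality of `P` and `Q` when they are reached immediately after the last atom of the
history `h`, the answer to which is that of the oracle `f`. -/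
def DerivAfter (f : A → List A → Bool) (P Q : PS A) : List A → Prop
  | [] => Deriv RpAx P Q
  | a :: h =>
    if f a h then ∀ z, Deriv RpAx (.cond P (.atom a) z) (.cond Q (.atom a) z)
    else ∀ z, Deriv RpAx (.cond z (.atom a) P) (.cond z (.atom a) Q)

theorem Deriv.derivAfter {P Q : PS A} (hd : Deriv RpAx P Q) (f : A → List A → Bool)
    (h : List A) : DerivAfter f P Q h := by
  cases h with
  | nil => exact hd
  | cons a h =>
    rw [DerivAfter]
    split
    · exact fun z => .congr hd (.refl _) (.refl _)
    · exact fun z => .congr (.refl _) (.refl _) hd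

/-- An answer to an atom that differs from the last one asked can be chosen freely. -/
theorem exists_repetitionProof_eq {f : A → List A → Bool} (hf : RepetitionProof f)
    {a : A} {h : List A} (ha : h.head? ≠ some a) (v : Bool) :
    ∃ g, RepetitionProof g ∧ (∀ x k, k.length < h.length → g x k = f x k) ∧ g a h = v := by
  classical
  refine ⟨fun x k => if x = a ∧ k.dropWhile (· = a) = h then v else f x k, ?_, ?_, ?_⟩
  · intro x k
    by_cases hx : x = a
    · subst hx
      simp [hf x k]
    · simp [hx, hf x k]
  · intro x k hk
    refine if_neg ?_
    rintro ⟨-, rfl⟩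
    exact absurd hk (not_lt.mpr (List.dropWhile_suffix _).length_le)
  · refine if_pos ⟨rfl, ?_⟩
    cases h with
    | nil => rfl
    | cons b h =>
      have : b ≠ a := by simpa using ha
      simp [this]

theorem derivAfter_of_run_eq (p q : BasicForm A) {f : A → List A → Bool}
    (hf : RepetitionProof f) (h : List A)
    (hpq : ∀ g, RepetitionProof g → (∀ x k, k.length < h.length → g x k = f x k) →
      p.run g h = q.run g h) :
    DerivAfter f p.toPS q.toPS h := by
  induction p generalizing q f h with
  | leaf b =>
    have hrun := hpq f hf fun _ _ _ => rfl
    cases q with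
    | leaf c =>
      obtain rfl : b = c := congrArg Prod.fst hrun
      exact (Deriv.refl _).derivAfter f h
    | node a l r =>
      have := (BasicForm.cons_suffix_run_node f a l r h).length_le
      rw [← hrun] at this
      simp [BasicForm.run] at this
  | node a l r ihl ihr =>
    have hrun := hpq f hf fun _ _ _ => rfl
    cases q with
    | leaf c =>
      have := (BasicForm.cons_suffix_run_node f a l r h).length_le
      rw [hrun] at this
      simp [BasicForm.run] at this
    | node a' l' r' =>
      have hs := BasicForm.cons_suffix_run_node f a l r h
      rw [hrun] at hs
      have hs' := List.suffix_of_suffix_length_le hs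
        (BasicForm.cons_suffix_run_node f a' l' r' h) le_rfl
      obtain rfl : a = a' := (List.cons.inj (hs'.eq_of_length rfl)).1
      have branch (g : A → List A → Bool) (hg : RepetitionProof g)
          (hgf : ∀ x k, k.length < h.length → g x k = f x k) :
          if g a h then DerivAfter g l.toPS l'.toPS (a :: h)
          else DerivAfter g r.toPS r'.toPS (a :: h) := by
        have step (g' : A → List A → Bool) (hg' : RepetitionProof g')
            (hgg : ∀ x k, k.length < (a :: h).length → g' x k = g x k) :
            (if g a h then l.run g' (a :: h) else r.run g' (a :: h)) =
              if g a h then l'.run g' (a :: h) else r'.run g' (a :: h) := by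
          have hr := hpq g' hg' fun x k hk =>
            (hgg x k (hk.trans (by simp))).trans (hgf x k hk)
          rwa [BasicForm.run, BasicForm.run, hgg a h (by simp)] at hr
        split
        next hv =>
          exact ihl l' hg (a :: h) fun g' hg' hgg => by simpa [hv] using step g' hg' hgg
        next hv =>
          exact ihr r' hg (a :: h) fun g' hg' hgg => by simpa [hv] using step g' hg' hgg
      by_cases ha : h.head? = some a
      · obtain ⟨h, rfl⟩ : ∃ k, h = a :: k := by
          cases h <;> simp_all
        have hb := branch f hf fun _ _ _ => rfl
        simp only [DerivAfter, hf a h] at hb ⊢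
        split
        next hv =>
          simp only [hv, if_true] at hb
          exact fun z => .trans (.ax (.rp1 ..)) <|
            .trans (.congr (hb _) (.refl _) (.refl _)) <|
            .trans (.ax (.rp1 ..)) (.symm (.ax (.rp1 ..)))
        next hv =>
          simp only [hv] at hb
          exact fun z => .trans (.ax (.rp2 ..)) <|
            .trans (.congr (.refl _) (.refl _) (hb _)) <|
            .trans (.ax (.rp2 ..)) (.symm (.ax (.rp2 ..)))
      · obtain ⟨g₁, hg₁, hgf₁, hv₁⟩ := exists_repetitionProof_eq hf ha true
        obtain ⟨g₂, hg₂, hgf₂, hv₂⟩ := exists_repetitionProof_eq hf ha false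
        have hl := branch g₁ hg₁ hgf₁
        have hr := branch g₂ hg₂ hgf₂
        simp only [DerivAfter, hv₁, if_true] at hl
        simp only [DerivAfter, hv₂, Bool.false_eq_true, if_false] at hr
        exact Deriv.derivAfter (.trans (hl _) (hr _)) f h

/-- **Axiomatization of repetition-proof valuation congruence**:
`CP_rp ⊢ P = Q` if and only if `P =_rp Q`. -/
theorem cp_rp_axiomatization {A : Type} [Countable A] [Nontrivial A]
    (P Q : PS A) : Deriv RpAx P Q ↔ KCong rpK P Q := by
  refine ⟨KCong.of_deriv, fun h => ?_⟩
  obtain ⟨p, hp⟩ := BasicForm.exists_deriv_toPS RpAx P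
  obtain ⟨q, hq⟩ := BasicForm.exists_deriv_toPS RpAx Q
  have hd : DerivAfter (fun _ _ => true) p.toPS q.toPS [] :=
    derivAfter_of_run_eq p q (fun _ _ => rfl) [] fun g hg _ =>
      run_eq_of_kEquiv (h.trans_deriv hp hq) hg []
  exact hp.trans (.trans hd hq.symm)
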